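/- Let 0<α<1 and 0<β<∞, let u be holomorphic on 𝔻 and φ a holomorphic self-map of 𝔻. Then uC_φ maps B^α boundedly into Z_β if and only if u ∈ Z_β, sup_{n≥0} (n+1)^α ‖(2u'φ' + uφ'')·φ^n‖_{ν_β} < ∞, and sup_{n≥0} (n+1)^{α+1} ‖u·(φ')²·φ^n‖_{ν_β} < ∞. -/

import Mathlib

open Complex Filter Set

noncomputable section

/-- The open unit disk in `ℂ`. -/
def unitDisk : Set ℂ := Metric.ball 0 1

/-- The weighted sup-norm `‖g‖_{ν_γ} = sup_{z ∈ 𝔻} (1-|z|²)^γ |g(z)|`. -/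
def wnorm (γ : ℝ) (g : ℂ → ℂ) : ℝ :=
  sSup ((fun z => (1 - ‖z‖ ^ 2) ^ γ * ‖g z‖) '' unitDisk)

/-- Membership in the weighted Banach space `H^∞_{ν_β}`. -/
def MemWeighted (β : ℝ) (g : ℂ → ℂ) : Prop :=
  DifferentiableOn ℂ g unitDisk ∧
    BddAbove ((fun z => (1 - ‖z‖ ^ 2) ^ β * ‖g z‖) '' unitDisk)

/-- Membership in the Bloch type space `B^α`. -/
def MemBloch (α : ℝ) (f : ℂ → ℂ) : Prop :=
  DifferentiableOn ℂ f unitDisk ∧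
    BddAbove ((fun z => (1 - ‖z‖ ^ 2) ^ α * ‖deriv f z‖) '' unitDisk)

/-- The Bloch type norm `‖f‖_{B^α} = |f(0)| + sup_{z∈𝔻}(1-|z|²)^α |f'(z)|`. -/
def blochNorm (α : ℝ) (f : ℂ → ℂ) : ℝ :=
  ‖f 0‖ + wnorm α (deriv f)

/-- Membership in the Zygmund type space `Z_β`. -/
def MemZygmund (β : ℝ) (f : ℂ → ℂ) : Prop :=
  DifferentiableOn ℂ f unitDisk ∧
    BddAbove ((fun z => (1 - ‖z‖ ^ 2) ^ β * ‖deriv (deriv f) z‖) '' unitDisk)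

/-- The Zygmund type norm `‖f‖_{Z_β} = |f(0)| + |f'(0)| + sup_{z∈𝔻}(1-|z|²)^β |f''(z)|`. -/
def zygNorm (β : ℝ) (f : ℂ → ℂ) : ℝ :=
  ‖f 0‖ + ‖deriv f 0‖ + wnorm β (deriv (deriv f))

/-- The weighted composition operator `uC_φ f = u · (f ∘ φ)`. -/
def wcomp (u φ f : ℂ → ℂ) : ℂ → ℂ := fun z => u z * f (φ z)

/-- `uC_φ` maps `B^α` boundedly into `Z_β`. -/
def BoundedBlochToZygmund (α β : ℝ) (u φ : ℂ → ℂ) : Prop :=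
  (∀ f, MemBloch α f → MemZygmund β (wcomp u φ f)) ∧
    ∃ C > 0, ∀ f, MemBloch α f → zygNorm β (wcomp u φ f) ≤ C * blochNorm α f

/-- `uC_φ` maps `B^α` boundedly into `H^∞_{ν_β}`. -/
def BoundedBlochToWeighted (α β : ℝ) (u φ : ℂ → ℂ) : Prop :=
  (∀ f, MemBloch α f → MemWeighted β (wcomp u φ f)) ∧
    ∃ C > 0, ∀ f, MemBloch α f → wnorm β (wcomp u φ f) ≤ C * blochNorm α f

/-- `uC_φ : B^α → Z_β` is compact: it is bounded and maps bounded sets of `B^α` to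
totally bounded (equivalently, since `Z_β` is complete, relatively compact) subsets
of `Z_β`. -/
def CompactBlochToZygmund (α β : ℝ) (u φ : ℂ → ℂ) : Prop :=
  BoundedBlochToZygmund α β u φ ∧
    ∀ r : ℝ, ∀ ε : ℝ, 0 < ε → ∃ T : Finset (ℂ → ℂ),
      (∀ g ∈ T, MemZygmund β g) ∧
      ∀ f, MemBloch α f → blochNorm α f ≤ r →
        ∃ g ∈ T, zygNorm β (fun z => wcomp u φ f z - g z) ≤ ε

/-- `uC_φ : B^α → H^∞_{ν_β}` is compact: it is bounded and maps bounded sets of `B^α`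
to totally bounded (equivalently, relatively compact) subsets of `H^∞_{ν_β}`. -/
def CompactBlochToWeighted (α β : ℝ) (u φ : ℂ → ℂ) : Prop :=
  BoundedBlochToWeighted α β u φ ∧
    ∀ r : ℝ, ∀ ε : ℝ, 0 < ε → ∃ T : Finset (ℂ → ℂ),
      (∀ g ∈ T, MemWeighted β g) ∧
      ∀ f, MemBloch α f → blochNorm α f ≤ r →
        ∃ g ∈ T, wnorm β (fun z => wcomp u φ f z - g z) ≤ ε

/-- A compact (linear, bounded, with totally bounded image of the unit ball) operator
from the subspace of `B^α` cut out by the predicate `P` into `Z_β`. -/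
def IsCompactOpToZygmund (α β : ℝ) (P : (ℂ → ℂ) → Prop) (K : (ℂ → ℂ) → ℂ → ℂ) : Prop :=
  (∀ f g, P f → P g → ∀ a b : ℂ,
      K (fun z => a * f z + b * g z) = fun z => a * K f z + b * K g z) ∧
  (∀ f, P f → MemZygmund β (K f)) ∧
  (∃ C, ∀ f, P f → zygNorm β (K f) ≤ C * blochNorm α f) ∧
  (∀ ε : ℝ, 0 < ε → ∃ T : Finset (ℂ → ℂ), (∀ g ∈ T, MemZygmund β g) ∧
      ∀ f, P f → blochNorm α f ≤ 1 → ∃ g ∈ T, zygNorm β (fun z => K f z - g z) ≤ ε)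

/-- The essential norm of `uC_φ`, as an operator from the subspace of `B^α` cut out by
the predicate `P` into `Z_β`: the distance to the compact operators, the operator norm
being the supremum over the unit ball. -/
def essNormZ (α β : ℝ) (P : (ℂ → ℂ) → Prop) (u φ : ℂ → ℂ) : ℝ :=
  sInf {r | ∃ K, IsCompactOpToZygmund α β P K ∧
    r = sSup {s | ∃ f, P f ∧ blochNorm α f ≤ 1 ∧
          s = zygNorm β (fun z => wcomp u φ f z - K f z)}}

/-- A compact (linear, bounded, with totally bounded image of the unit ball) operator
from `B^α` into `H^∞_{ν_β}`. -/
def IsCompactOpToWeighted (α β : ℝ) (K : (ℂ → ℂ) → ℂ → ℂ) : Prop :=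
  (∀ f g, MemBloch α f → MemBloch α g → ∀ a b : ℂ,
      K (fun z => a * f z + b * g z) = fun z => a * K f z + b * K g z) ∧
  (∀ f, MemBloch α f → MemWeighted β (K f)) ∧
  (∃ C, ∀ f, MemBloch α f → wnorm β (K f) ≤ C * blochNorm α f) ∧
  (∀ ε : ℝ, 0 < ε → ∃ T : Finset (ℂ → ℂ), (∀ g ∈ T, MemWeighted β g) ∧
      ∀ f, MemBloch α f → blochNorm α f ≤ 1 → ∃ g ∈ T, wnorm β (fun z => K f z - g z) ≤ ε)

/-- The essential norm of `uC_φ : B^α → H^∞_{ν_β}`. -/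
def essNormW (α β : ℝ) (u φ : ℂ → ℂ) : ℝ :=
  sInf {r | ∃ K, IsCompactOpToWeighted α β K ∧
    r = sSup {s | ∃ f, MemBloch α f ∧ blochNorm α f ≤ 1 ∧
          s = wnorm β (fun z => wcomp u φ f z - K f z)}}

/-- `limsup_{|φ(z)|→1} F(z) = lim_{s→1⁻} sup {F z : z ∈ 𝔻, |φ z| > s}`.  Since the inner
supremum is nonincreasing in `s`, the limit equals the infimum over `s ∈ [0,1)`; note
that `Real.sSup ∅ = 0`, matching the convention that the value is `0` when
`{z : |φ z| > s}` is empty for some `s < 1`. -/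
def phiLimsup (φ : ℂ → ℂ) (F : ℂ → ℝ) : ℝ :=
  sInf ((fun s => sSup {y | ∃ z ∈ unitDisk, s < ‖φ z‖ ∧ y = F z}) '' Set.Ico (0:ℝ) 1)

lemma isOpen_unitDisk : IsOpen unitDisk := Metric.isOpen_ball

lemma mem_unitDisk {z : ℂ} : z ∈ unitDisk ↔ ‖z‖ < 1 := by simp [unitDisk]

lemma weight_nonneg {z : ℂ} (hz : z ∈ unitDisk) (γ : ℝ) : 0 ≤ (1 - ‖z‖ ^ 2) ^ γ := by
  have h := mem_unitDisk.1 hz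
  exact Real.rpow_nonneg (by nlinarith [norm_nonneg z]) _

lemma wnorm_nonneg (γ : ℝ) (g : ℂ → ℂ) : 0 ≤ wnorm γ g := by
  apply Real.sSup_nonneg
  rintro _ ⟨z, hz, rfl⟩
  exact mul_nonneg (weight_nonneg hz γ) (norm_nonneg _)

lemma le_wnorm {γ : ℝ} {g : ℂ → ℂ}
    (hg : BddAbove ((fun z => (1 - ‖z‖ ^ 2) ^ γ * ‖g z‖) '' unitDisk)) {z : ℂ}
    (hz : z ∈ unitDisk) : (1 - ‖z‖ ^ 2) ^ γ * ‖g z‖ ≤ wnorm γ g :=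
  le_csSup hg ⟨z, hz, rfl⟩

lemma wnorm_le {γ : ℝ} {g : ℂ → ℂ} {C : ℝ}
    (h : ∀ z ∈ unitDisk, (1 - ‖z‖ ^ 2) ^ γ * ‖g z‖ ≤ C) : wnorm γ g ≤ C := by
  apply csSup_le
  · exact ⟨_, 0, by simp [mem_unitDisk], rfl⟩
  · rintro _ ⟨z, hz, rfl⟩
    exact h z hz

lemma deriv_wcomp {u φ f : ℂ → ℂ} (hu : DifferentiableOn ℂ u unitDisk)
    (hφd : DifferentiableOn ℂ φ unitDisk) (hφm : Set.MapsTo φ unitDisk unitDisk)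
    (hf : DifferentiableOn ℂ f unitDisk) {z : ℂ} (hz : z ∈ unitDisk) :
    deriv (wcomp u φ f) z = deriv u z * f (φ z) + u z * (deriv f (φ z) * deriv φ z) := by
  have h1 := (hu.differentiableAt (isOpen_unitDisk.mem_nhds hz)).hasDerivAt
  have h2 := (hφd.differentiableAt (isOpen_unitDisk.mem_nhds hz)).hasDerivAt
  have h3 := (hf.differentiableAt (isOpen_unitDisk.mem_nhds (hφm hz))).hasDerivAt
  exact (h1.mul (h3.comp z h2)).deriv

lemma deriv_deriv_wcomp {u φ f : ℂ → ℂ} (hu : DifferentiableOn ℂ u unitDisk)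
    (hφd : DifferentiableOn ℂ φ unitDisk) (hφm : Set.MapsTo φ unitDisk unitDisk)
    (hf : DifferentiableOn ℂ f unitDisk) {z : ℂ} (hz : z ∈ unitDisk) :
    deriv (deriv (wcomp u φ f)) z = deriv (deriv u) z * f (φ z)
      + (2 * deriv u z * deriv φ z + u z * deriv (deriv φ) z) * deriv f (φ z)
      + u z * deriv φ z ^ 2 * deriv (deriv f) (φ z) := by
  have hev : deriv (wcomp u φ f) =ᶠ[nhds z]
      fun z => deriv u z * f (φ z) + u z * (deriv f (φ z) * deriv φ z) := by
    filter_upwards [isOpen_unitDisk.mem_nhds hz] with y hy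
    exact deriv_wcomp hu hφd hφm hf hy
  have hd : ∀ {g : ℂ → ℂ}, DifferentiableOn ℂ g unitDisk → ∀ {y}, y ∈ unitDisk →
      HasDerivAt g (deriv g y) y := fun hg _ hy =>
    (hg.differentiableAt (isOpen_unitDisk.mem_nhds hy)).hasDerivAt
  have h1 := hd hu hz
  have h1' := hd (hu.deriv isOpen_unitDisk) hz
  have h2 := hd hφd hz
  have h2' := hd (hφd.deriv isOpen_unitDisk) hz
  have h3 := (hd hf (hφm hz)).comp z h2
  have h3' := (hd (hf.deriv isOpen_unitDisk) (hφm hz)).comp z h2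
  rw [hev.deriv_eq]
  refine (((h1'.mul h3).add (h1.mul (h3'.mul h2'))).deriv).trans ?_
  simp only [Function.comp_apply, Pi.mul_apply]
  ring

lemma differentiableOn_wcomp {u φ f : ℂ → ℂ} (hu : DifferentiableOn ℂ u unitDisk)
    (hφd : DifferentiableOn ℂ φ unitDisk) (hφm : Set.MapsTo φ unitDisk unitDisk)
    (hf : DifferentiableOn ℂ f unitDisk) : DifferentiableOn ℂ (wcomp u φ f) unitDisk :=
  hu.mul (hf.comp hφd hφm)

lemma mul_one_sub_mul_pow_le_one {r : ℝ} (h0 : 0 ≤ r) (h1 : r ≤ 1) (n : ℕ) :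
    ((n : ℝ) + 1) * (1 - r) * r ^ n ≤ 1 := by
  have h : ((n : ℝ) + 1) * r ^ n ≤ ∑ i ∈ Finset.range (n + 1), r ^ i := by
    have := Finset.card_nsmul_le_sum (Finset.range (n + 1)) (fun i => r ^ i) (r ^ n)
      (fun i hi => pow_le_pow_of_le_one h0 h1 (Nat.lt_succ_iff.1 (Finset.mem_range.1 hi)))
    simpa using this
  have hg := mul_neg_geom_sum r (n + 1)
  have hp : 0 ≤ r ^ (n + 1) := pow_nonneg h0 _
  nlinarith [mul_le_mul_of_nonneg_left h (sub_nonneg.2 h1)]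

/-- The derivative of the monomial `z ^ (n + 1)` has `α`-weighted norm `O((n + 1) ^ (1 - α))`. -/
lemma weight_mul_monomial_le {α : ℝ} (hα0 : 0 < α) (hα1 : α < 1) {r : ℝ} (h0 : 0 ≤ r)
    (h1 : r < 1) (n : ℕ) :
    (1 - r ^ 2) ^ α * (((n : ℝ) + 1) * r ^ n) ≤ 2 * ((n : ℝ) + 1) ^ (1 - α) := by
  have hn : (0 : ℝ) < (n : ℝ) + 1 := by positivity
  have hr : 0 ≤ 1 - r := by linarith
  have hrn : 0 ≤ r ^ n := pow_nonneg h0 n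
  have e1 : (1 - r ^ 2) ^ α ≤ 2 * (1 - r) ^ α := by
    calc (1 - r ^ 2) ^ α ≤ (2 * (1 - r)) ^ α :=
          Real.rpow_le_rpow (by nlinarith) (by nlinarith) hα0.le
      _ = 2 ^ α * (1 - r) ^ α := Real.mul_rpow (by norm_num) hr
      _ ≤ 2 * (1 - r) ^ α := by
          gcongr
          simpa using Real.rpow_le_rpow_of_exponent_le (one_le_two (α := ℝ)) hα1.le
  have e2 : r ^ n ≤ (r ^ n) ^ α := by
    simpa using Real.rpow_le_rpow_of_exponent_ge' hrn (pow_le_one₀ h0 h1.le) hα0.le hα1.le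
  have e3 : ((n : ℝ) + 1) ^ α * (1 - r) ^ α * (r ^ n) ^ α ≤ 1 := by
    rw [← Real.mul_rpow hn.le hr, ← Real.mul_rpow (by positivity) hrn]
    exact Real.rpow_le_one (by positivity) (mul_one_sub_mul_pow_le_one h0 h1.le n) hα0.le
  have e4 : (n : ℝ) + 1 = ((n : ℝ) + 1) ^ (1 - α) * ((n : ℝ) + 1) ^ α := by
    rw [← Real.rpow_add hn]; simp
  calc (1 - r ^ 2) ^ α * (((n : ℝ) + 1) * r ^ n)
      ≤ (2 * (1 - r) ^ α) * (((n : ℝ) + 1) * (r ^ n) ^ α) := by gcongr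
    _ = 2 * ((n : ℝ) + 1) ^ (1 - α) * (((n : ℝ) + 1) ^ α * (1 - r) ^ α * (r ^ n) ^ α) := by
        nth_rewrite 1 [e4]; ring
    _ ≤ 2 * ((n : ℝ) + 1) ^ (1 - α) * 1 := by gcongr
    _ = _ := mul_one _

lemma exists_rpow_neg_le {r : ℝ} (h0 : 0 ≤ r) (h1 : r < 1) {s : ℝ} (hs : 0 ≤ s) :
    ∃ n : ℕ, ((1 - r) / 2) ^ (-s) ≤ 2 * 4 ^ s * (((n : ℝ) + 1) ^ s * r ^ n) := by
  have hr : 0 < 1 - r := by linarith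
  refine ⟨⌊1 / (2 * (1 - r))⌋₊, ?_⟩
  set n := ⌊1 / (2 * (1 - r))⌋₊
  have hn1 : (n : ℝ) ≤ 1 / (2 * (1 - r)) := Nat.floor_le (by positivity)
  have hn2 : 1 / (2 * (1 - r)) < (n : ℝ) + 1 := Nat.lt_floor_add_one _
  have hp : 1 / 2 ≤ r ^ n := by
    have hb := one_add_mul_le_pow (a := r - 1) (by linarith) n
    have hn3 : (n : ℝ) * (1 - r) ≤ 1 / 2 := by
      calc (n : ℝ) * (1 - r) ≤ 1 / (2 * (1 - r)) * (1 - r) := by gcongr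
        _ = 1 / 2 := by field_simp
    rw [add_sub_cancel] at hb
    linarith
  rw [Real.rpow_neg (by positivity), ← Real.inv_rpow (by positivity)]
  calc (((1 - r) / 2)⁻¹) ^ s ≤ (4 * ((n : ℝ) + 1)) ^ s := by
        apply Real.rpow_le_rpow (by positivity) _ hs
        have : ((1 - r) / 2)⁻¹ = 4 * (1 / (2 * (1 - r))) := by field_simp; norm_num
        rw [this]; gcongr
    _ = 2 * 4 ^ s * (((n : ℝ) + 1) ^ s * (1 / 2)) := by
        rw [Real.mul_rpow (by norm_num) (by positivity)]; ring
    _ ≤ _ := by gcongr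

lemma norm_le_mul_rpow_neg {γ δ : ℝ} (hγ : 0 ≤ γ) (hδ : 0 < δ) {z a : ℂ} {M : ℝ}
    (hz : δ ≤ 1 - ‖z‖) (h : (1 - ‖z‖ ^ 2) ^ γ * ‖a‖ ≤ M) : ‖a‖ ≤ M * δ ^ (-γ) := by
  have h1 : δ ^ γ ≤ (1 - ‖z‖ ^ 2) ^ γ :=
    Real.rpow_le_rpow hδ.le (by nlinarith [norm_nonneg z]) hγ
  rw [Real.rpow_neg hδ.le, ← div_eq_mul_inv, le_div_iff₀ (by positivity), mul_comm]
  exact (mul_le_mul_of_nonneg_right h1 (norm_nonneg _)).trans h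

lemma norm_deriv_deriv_le {α : ℝ} (hα0 : 0 < α) {f : ℂ → ℂ} (hf : MemBloch α f) {w : ℂ}
    (hw : w ∈ unitDisk) :
    ‖deriv (deriv f) w‖ ≤ wnorm α (deriv f) * ((1 - ‖w‖) / 2) ^ (-(α + 1)) := by
  have hw1 := mem_unitDisk.1 hw
  have hδ : 0 < (1 - ‖w‖) / 2 := by linarith
  set δ := (1 - ‖w‖) / 2 with hδdef
  have hmem : ∀ ζ ∈ Metric.closedBall w δ, δ ≤ 1 - ‖ζ‖ := by
    intro ζ hζ
    have h2 : ‖ζ - w‖ ≤ δ := by simpa [dist_eq_norm] using hζ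
    have h3 := norm_sub_norm_le ζ w
    linarith
  have hsub : Metric.closedBall w δ ⊆ unitDisk := fun ζ hζ =>
    mem_unitDisk.2 (by linarith [hmem ζ hζ])
  have hd : DifferentiableOn ℂ (deriv f) (closure (Metric.ball w δ)) :=
    (hf.1.deriv isOpen_unitDisk).mono (Metric.closure_ball_subset_closedBall.trans hsub)
  have hC : ∀ ζ ∈ Metric.sphere w δ, ‖deriv f ζ‖ ≤ wnorm α (deriv f) * δ ^ (-α) := by
    intro ζ hζ
    have hζ' := Metric.sphere_subset_closedBall hζ
    exact norm_le_mul_rpow_neg hα0.le hδ (hmem ζ hζ') (le_wnorm hf.2 (hsub hζ'))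
  refine (Complex.norm_deriv_le_of_forall_mem_sphere_norm_le hδ hd.diffContOnCl hC).trans_eq ?_
  rw [show -(α + 1) = -α - 1 by ring, Real.rpow_sub hδ, Real.rpow_one, mul_div_assoc]

/-- For `α < 1`, functions in the Bloch type space `B^α` are bounded. -/
lemma norm_le_blochNorm {α : ℝ} (hα0 : 0 < α) (hα1 : α < 1) {f : ℂ → ℂ} (hf : MemBloch α f)
    {w : ℂ} (hw : w ∈ unitDisk) : ‖f w‖ ≤ ‖f 0‖ + wnorm α (deriv f) / (1 - α) := by
  have hw1 := mem_unitDisk.1 hw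
  set M := wnorm α (deriv f)
  have hM : 0 ≤ M := wnorm_nonneg _ _
  have hα : 0 < 1 - α := by linarith
  have hmem : ∀ t ∈ Set.Icc (0 : ℝ) 1, (t : ℂ) * w ∈ unitDisk := by
    intro t ht
    rw [mem_unitDisk, norm_mul, Complex.norm_real, Real.norm_of_nonneg ht.1]
    nlinarith [ht.1, ht.2, norm_nonneg w]
  have hder : ∀ t ∈ Set.Icc (0 : ℝ) 1,
      HasDerivAt (fun t : ℝ => f (t * w)) (deriv f (t * w) * w) t := by
    intro t ht
    have h1 := (hf.1.differentiableAt (isOpen_unitDisk.mem_nhds (hmem t ht))).hasDerivAt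
    have h2 : HasDerivAt (fun t : ℝ => (t : ℂ) * w) w t := by
      simpa using (Complex.ofRealCLM.hasDerivAt (x := t)).mul_const w
    exact h1.comp t h2
  have key := image_norm_le_of_norm_deriv_right_le_deriv_boundary'
    (f := fun t : ℝ => f (t * w)) (f' := fun t : ℝ => deriv f (t * w) * w) (a := 0) (b := 1)
    (B := fun t => ‖f 0‖ + M * ((1 - (1 - t) ^ (1 - α)) / (1 - α)))
    (B' := fun t => M * (1 - t) ^ (-α))
    (fun t ht => (hder t ht).continuousAt.continuousWithinAt)
    (fun t ht => (hder t ⟨ht.1, ht.2.le⟩).hasDerivWithinAt)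
    (by simp)
    (by
      apply Continuous.continuousOn
      have : Continuous fun t : ℝ => (1 - t) ^ (1 - α) :=
        (continuous_const.sub continuous_id).rpow_const fun _ => Or.inr hα.le
      fun_prop)
    (by
      intro t ht
      apply HasDerivAt.hasDerivWithinAt
      have h1 : HasDerivAt (fun t : ℝ => 1 - t) (-1) t := by
        simpa using (hasDerivAt_id t).const_sub 1
      have h2 := h1.rpow_const (p := 1 - α) (Or.inl (by linarith [ht.2] : 1 - t ≠ 0 ))
      have h3 := (((h2.const_sub 1).div_const (1 - α)).const_mul M).const_add ‖f 0‖
      convert h3 using 1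
      rw [show 1 - α - 1 = -α by ring]
      field_simp)
    (by
      intro t ht
      have h1 : 0 < 1 - t := by linarith [ht.2]
      have hz := hmem t ⟨ht.1, ht.2.le⟩
      have h2 : 1 - t ≤ 1 - ‖(t : ℂ) * w‖ := by
        rw [norm_mul, Complex.norm_real, Real.norm_of_nonneg ht.1]
        nlinarith [ht.1, norm_nonneg w]
      have h3 := norm_le_mul_rpow_neg hα0.le h1 h2 (le_wnorm hf.2 hz)
      rw [norm_mul]
      exact (mul_le_of_le_one_right (norm_nonneg _) hw1.le).trans h3)
    (Set.right_mem_Icc.2 zero_le_one)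
  simpa [Real.zero_rpow hα.ne', div_eq_mul_inv] using key

lemma weight_mul_le_of_sequence {β s : ℝ} (hs : 0 ≤ s) {φ g : ℂ → ℂ}
    (hφm : Set.MapsTo φ unitDisk unitDisk) {C : ℝ}
    (hC : ∀ n : ℕ, ∀ z ∈ unitDisk,
      ((n : ℝ) + 1) ^ s * ((1 - ‖z‖ ^ 2) ^ β * ‖g z * φ z ^ n‖) ≤ C) {z : ℂ}
    (hz : z ∈ unitDisk) :
    (1 - ‖z‖ ^ 2) ^ β * ‖g z‖ * ((1 - ‖φ z‖) / 2) ^ (-s) ≤ 2 * 4 ^ s * C := by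
  obtain ⟨n, hn⟩ := exists_rpow_neg_le (norm_nonneg (φ z)) (mem_unitDisk.1 (hφm hz)) hs
  have hW := weight_nonneg hz β
  calc (1 - ‖z‖ ^ 2) ^ β * ‖g z‖ * ((1 - ‖φ z‖) / 2) ^ (-s)
      ≤ (1 - ‖z‖ ^ 2) ^ β * ‖g z‖ * (2 * 4 ^ s * (((n : ℝ) + 1) ^ s * ‖φ z‖ ^ n)) := by gcongr
    _ = 2 * 4 ^ s * (((n : ℝ) + 1) ^ s * ((1 - ‖z‖ ^ 2) ^ β * ‖g z * φ z ^ n‖)) := by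
        rw [norm_mul, norm_pow]; ring
    _ ≤ 2 * 4 ^ s * C := by gcongr; exact hC n z hz

lemma boundedBlochToZygmund_of_sequences {α β : ℝ} (hα0 : 0 < α) (hα1 : α < 1)
    {u φ : ℂ → ℂ} (hφd : DifferentiableOn ℂ φ unitDisk)
    (hφm : Set.MapsTo φ unitDisk unitDisk) (hu : MemZygmund β u) {C₁ C₂ : ℝ}
    (h₁ : ∀ n : ℕ, ∀ z ∈ unitDisk, ((n : ℝ) + 1) ^ α * ((1 - ‖z‖ ^ 2) ^ β *
      ‖(2 * deriv u z * deriv φ z + u z * deriv (deriv φ) z) * φ z ^ n‖) ≤ C₁)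
    (h₂ : ∀ n : ℕ, ∀ z ∈ unitDisk, ((n : ℝ) + 1) ^ (α + 1) *
      ((1 - ‖z‖ ^ 2) ^ β * ‖u z * deriv φ z ^ 2 * φ z ^ n‖) ≤ C₂) :
    BoundedBlochToZygmund α β u φ := by
  have hα : 0 < 1 - α := by linarith
  have h0 : (0 : ℂ) ∈ unitDisk := by simp [mem_unitDisk]
  set K := 1 + 1 / (1 - α)
  have hK : 0 ≤ K := by positivity
  have hval : ∀ f, MemBloch α f → ∀ w ∈ unitDisk, ‖f w‖ ≤ K * blochNorm α f := by
    intro f hf w hw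
    have h := norm_le_blochNorm hα0 hα1 hf hw
    have hM := wnorm_nonneg α (deriv f)
    have h' : 0 ≤ 1 / (1 - α) * ‖f 0‖ := by positivity
    rw [div_eq_mul_one_div, mul_comm] at h
    simp only [blochNorm, K]
    nlinarith [h]
  have hder : ∀ f, MemBloch α f → ∀ w ∈ unitDisk,
      ‖deriv f w‖ ≤ blochNorm α f * ((1 - ‖w‖) / 2) ^ (-α) := by
    intro f hf w hw
    have hw1 := mem_unitDisk.1 hw
    have hle : wnorm α (deriv f) ≤ blochNorm α f := by simp [blochNorm]
    exact norm_le_mul_rpow_neg hα0.le (by linarith) (by linarith) ((le_wnorm hf.2 hw).trans hle)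
  have hder2 : ∀ f, MemBloch α f → ∀ w ∈ unitDisk,
      ‖deriv (deriv f) w‖ ≤ blochNorm α f * ((1 - ‖w‖) / 2) ^ (-(α + 1)) := by
    intro f hf w hw
    have hw1 := mem_unitDisk.1 hw
    have hδ : 0 ≤ (1 - ‖w‖) / 2 := by linarith
    refine (norm_deriv_deriv_le hα0 hf hw).trans ?_
    gcongr
    simp [blochNorm]
  set U := wnorm β (deriv (deriv u))
  set D := K * U + 2 * 4 ^ α * C₁ + 2 * 4 ^ (α + 1) * C₂
  have hmain : ∀ f, MemBloch α f → ∀ z ∈ unitDisk,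
      (1 - ‖z‖ ^ 2) ^ β * ‖deriv (deriv (wcomp u φ f)) z‖ ≤ D * blochNorm α f := by
    intro f hf z hz
    have hb : 0 ≤ blochNorm α f := add_nonneg (norm_nonneg _) (wnorm_nonneg _ _)
    rw [deriv_deriv_wcomp hu.1 hφd hφm hf.1 hz]
    have hW := weight_nonneg hz β
    set W := (1 - ‖z‖ ^ 2) ^ β
    have hA := weight_mul_le_of_sequence hα0.le hφm h₁ hz
    have hB := weight_mul_le_of_sequence (by linarith : 0 ≤ α + 1) hφm h₂ hz
    have hU : W * ‖deriv (deriv u) z‖ ≤ U := le_wnorm hu.2 hz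
    set A := 2 * deriv u z * deriv φ z + u z * deriv (deriv φ) z
    set B := u z * deriv φ z ^ 2
    calc W * ‖deriv (deriv u) z * f (φ z) + A * deriv f (φ z) + B * deriv (deriv f) (φ z)‖
        ≤ W * (‖deriv (deriv u) z‖ * ‖f (φ z)‖ + ‖A‖ * ‖deriv f (φ z)‖
            + ‖B‖ * ‖deriv (deriv f) (φ z)‖) := by
          gcongr
          refine norm_add₃_le.trans_eq ?_
          simp only [norm_mul]
      _ ≤ W * (‖deriv (deriv u) z‖ * (K * blochNorm α f)
            + ‖A‖ * (blochNorm α f * ((1 - ‖φ z‖) / 2) ^ (-α))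
            + ‖B‖ * (blochNorm α f * ((1 - ‖φ z‖) / 2) ^ (-(α + 1)))) := by
          gcongr
          · exact hval f hf _ (hφm hz)
          · exact hder f hf _ (hφm hz)
          · exact hder2 f hf _ (hφm hz)
      _ = (K * (W * ‖deriv (deriv u) z‖) + W * ‖A‖ * ((1 - ‖φ z‖) / 2) ^ (-α)
            + W * ‖B‖ * ((1 - ‖φ z‖) / 2) ^ (-(α + 1))) * blochNorm α f := by ring
      _ ≤ D * blochNorm α f := by
          refine mul_le_mul_of_nonneg_right ?_ hb
          exact add_le_add (add_le_add (mul_le_mul_of_nonneg_left hU hK) hA) hB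
  refine ⟨fun f hf => ⟨differentiableOn_wcomp hu.1 hφd hφm hf.1, D * blochNorm α f, ?_⟩, ?_⟩
  · rintro _ ⟨z, hz, rfl⟩
    exact hmain f hf z hz
  · set E := ‖u 0‖ * K + (‖deriv u 0‖ * K +
      ‖u 0‖ * (((1 - ‖φ 0‖) / 2) ^ (-α) * ‖deriv φ 0‖)) + D
    refine ⟨|E| + 1, by positivity, fun f hf => ?_⟩
    have hb : 0 ≤ blochNorm α f := add_nonneg (norm_nonneg _) (wnorm_nonneg _ _)
    have h₀ : ‖wcomp u φ f 0‖ ≤ ‖u 0‖ * (K * blochNorm α f) := by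
      rw [wcomp, norm_mul]
      gcongr
      exact hval f hf _ (hφm h0)
    have h₀' : ‖deriv (wcomp u φ f) 0‖ ≤ ‖deriv u 0‖ * (K * blochNorm α f) +
        ‖u 0‖ * (blochNorm α f * ((1 - ‖φ 0‖) / 2) ^ (-α) * ‖deriv φ 0‖) := by
      rw [deriv_wcomp hu.1 hφd hφm hf.1 h0]
      refine (norm_add_le _ _).trans ?_
      simp only [norm_mul]
      gcongr
      · exact hval f hf _ (hφm h0)
      · exact hder f hf _ (hφm h0)
    have h₀'' := wnorm_le (hmain f hf)
    calc zygNorm β (wcomp u φ f) ≤ E * blochNorm α f := by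
          simp only [zygNorm, E]
          linarith
      _ ≤ (|E| + 1) * blochNorm α f := by
          gcongr
          linarith [le_abs_self E]

lemma memBloch_pow {α : ℝ} (hα0 : 0 < α) (hα1 : α < 1) (n : ℕ) :
    MemBloch α (fun z => z ^ (n + 1)) ∧
      blochNorm α (fun z => z ^ (n + 1)) ≤ 2 * ((n : ℝ) + 1) ^ (1 - α) := by
  have h : ∀ z ∈ unitDisk, (1 - ‖z‖ ^ 2) ^ α * ‖deriv (fun z : ℂ => z ^ (n + 1)) z‖ ≤
      2 * ((n : ℝ) + 1) ^ (1 - α) := by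
    intro z hz
    have hn : ‖(n : ℂ) + 1‖ = (n : ℝ) + 1 := by
      exact_mod_cast Complex.norm_natCast (n + 1)
    rw [deriv_pow_field, norm_mul, norm_pow]
    push_cast
    rw [hn]
    exact weight_mul_monomial_le hα0 hα1 (norm_nonneg z) (mem_unitDisk.1 hz) n
  refine ⟨⟨(differentiable_pow _).differentiableOn, 2 * ((n : ℝ) + 1) ^ (1 - α), ?_⟩, ?_⟩
  · rintro _ ⟨z, hz, rfl⟩
    exact h z hz
  · simpa [blochNorm] using wnorm_le h

lemma memBloch_one (α : ℝ) : MemBloch α (fun _ => 1) :=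
  ⟨differentiableOn_const _, 0, by rintro _ ⟨z, -, rfl⟩; simp⟩

/-- The coefficients `A`, `B` are recovered from the sums `w ^ (k+1) A + (k+1) w ^ k B`. -/
lemma coefficient_bounds {α : ℝ} (hα0 : 0 < α) (hα1 : α < 1) {W C : ℝ} (hW : 0 ≤ W)
    {A B w : ℂ} (hw : ‖w‖ ≤ 1) (hA : W * ‖A‖ ≤ C)
    (hF : ∀ k : ℕ, ((k : ℝ) + 1) ^ α * (W * ‖w ^ (k + 1) * A + (k + 1) * w ^ k * B‖) ≤ C)
    (n : ℕ) :
    ((n : ℝ) + 1) ^ α * (W * ‖A * w ^ n‖) ≤ 34 * C ∧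
      ((n : ℝ) + 1) ^ (α + 1) * (W * ‖B * w ^ n‖) ≤ 16 * C := by
  have hC : 0 ≤ C := (by positivity : 0 ≤ W * ‖A‖).trans hA
  have heven : ∀ k : ℕ, ((k : ℝ) + 1) ^ (α + 1) * (W * ‖B * w ^ (2 * k)‖) ≤ 4 * C := by
    intro k
    rcases Nat.eq_zero_or_pos k with rfl | hk
    · have h := hF 0
      simp only [Nat.cast_zero, zero_add, Real.one_rpow, one_mul, pow_zero, pow_one,
        mul_zero, mul_one] at h ⊢
      have h1 : ‖B‖ ≤ ‖w * A + B‖ + ‖A‖ := by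
        calc ‖B‖ = ‖(w * A + B) - w * A‖ := by congr 1; ring
          _ ≤ ‖w * A + B‖ + ‖w * A‖ := norm_sub_le _ _
          _ ≤ ‖w * A + B‖ + ‖A‖ := by
            rw [norm_mul]
            linarith [mul_le_of_le_one_left (norm_nonneg A) hw]
      linarith [mul_le_mul_of_nonneg_left h1 hW]
    · have hk' : (1 : ℝ) ≤ k := by exact_mod_cast hk
      set F : ℕ → ℂ := fun k => w ^ (k + 1) * A + (k + 1) * w ^ k * B with hFdef
      have e : (k : ℂ) * (B * w ^ (2 * k)) = F (2 * k) - w ^ k * F k := by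
        simp only [hFdef]; push_cast; ring
      have e1 : (k : ℝ) * ‖B * w ^ (2 * k)‖ ≤ ‖F (2 * k)‖ + ‖F k‖ := by
        calc (k : ℝ) * ‖B * w ^ (2 * k)‖ = ‖F (2 * k) - w ^ k * F k‖ := by
              rw [← e, norm_mul (k : ℂ), Complex.norm_natCast]
          _ ≤ ‖F (2 * k)‖ + ‖w ^ k * F k‖ := norm_sub_le _ _
          _ ≤ _ := by
            rw [norm_mul, norm_pow]
            linarith [mul_le_of_le_one_left (norm_nonneg (F k))
              (pow_le_one₀ (norm_nonneg w) hw (n := k))]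
      have e2 : ((k : ℝ) + 1) ^ α * (W * ‖F (2 * k)‖) ≤ C := by
        refine le_trans ?_ (hF (2 * k))
        have hk2 : (k : ℝ) ≤ (2 * k : ℕ) := by push_cast; linarith
        exact mul_le_mul_of_nonneg_right (by gcongr) (by positivity)
      have e3 := hF k
      calc ((k : ℝ) + 1) ^ (α + 1) * (W * ‖B * w ^ (2 * k)‖)
          = ((k : ℝ) + 1) ^ α * (W * (((k : ℝ) + 1) * ‖B * w ^ (2 * k)‖)) := by
            rw [Real.rpow_add_one (by positivity)]; ring
        _ ≤ ((k : ℝ) + 1) ^ α * (W * (2 * (‖F (2 * k)‖ + ‖F k‖))) := by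
            have e4 : ((k : ℝ) + 1) * ‖B * w ^ (2 * k)‖ ≤ 2 * (‖F (2 * k)‖ + ‖F k‖) := by
              nlinarith [norm_nonneg (B * w ^ (2 * k))]
            exact mul_le_mul_of_nonneg_left (mul_le_mul_of_nonneg_left e4 hW) (by positivity)
        _ = 2 * (((k : ℝ) + 1) ^ α * (W * ‖F (2 * k)‖) +
              ((k : ℝ) + 1) ^ α * (W * ‖F k‖)) := by ring
        _ ≤ 4 * C := by linarith
  have hB : ∀ n : ℕ, ((n : ℝ) + 1) ^ (α + 1) * (W * ‖B * w ^ n‖) ≤ 16 * C := by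
    intro n
    have hn : (n : ℝ) + 1 ≤ 2 * (((n / 2 : ℕ) : ℝ) + 1) := by
      have : n + 1 ≤ 2 * (n / 2 + 1) := by omega
      exact_mod_cast this
    have h2 : (2 : ℝ) ^ (α + 1) ≤ 4 := by
      calc (2 : ℝ) ^ (α + 1) ≤ 2 ^ (2 : ℝ) :=
            Real.rpow_le_rpow_of_exponent_le one_le_two (by linarith)
        _ = 4 := by norm_num
    calc ((n : ℝ) + 1) ^ (α + 1) * (W * ‖B * w ^ n‖)
        ≤ (2 * (((n / 2 : ℕ) : ℝ) + 1)) ^ (α + 1) * (W * ‖B * w ^ (2 * (n / 2))‖) := by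
          simp only [norm_mul, norm_pow]
          gcongr ?_ * (W * (‖B‖ * ?_))
          · exact Real.rpow_le_rpow (by positivity) hn (by linarith)
          · exact pow_le_pow_of_le_one (norm_nonneg _) hw (by omega)
      _ = 2 ^ (α + 1) * ((((n / 2 : ℕ) : ℝ) + 1) ^ (α + 1) *
            (W * ‖B * w ^ (2 * (n / 2))‖)) := by
          rw [Real.mul_rpow (by norm_num) (by positivity)]; ring
      _ ≤ 4 * (4 * C) := mul_le_mul h2 (heven _) (by positivity) (by norm_num)
      _ = 16 * C := by ring
  refine ⟨?_, hB n⟩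
  rcases n with _ | k
  · simp only [Nat.cast_zero, zero_add, Real.one_rpow, one_mul, pow_zero, mul_one]
    linarith
  · have e : A * w ^ (k + 1) = (w ^ (k + 1) * A + (k + 1) * w ^ k * B)
        - ((k : ℂ) + 1) * (B * w ^ k) := by ring
    have e1 : ‖A * w ^ (k + 1)‖ ≤ ‖w ^ (k + 1) * A + (k + 1) * w ^ k * B‖ +
        ((k : ℝ) + 1) * ‖B * w ^ k‖ := by
      have hk : ‖(k : ℂ) + 1‖ = (k : ℝ) + 1 := by
        exact_mod_cast Complex.norm_natCast (k + 1)
      rw [e, ← hk, ← norm_mul]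
      exact norm_sub_le _ _
    have e2 : (((k + 1 : ℕ) : ℝ) + 1) ^ α ≤ 2 * ((k : ℝ) + 1) ^ α := by
      calc (((k + 1 : ℕ) : ℝ) + 1) ^ α ≤ (2 * ((k : ℝ) + 1)) ^ α := by
            gcongr
            push_cast
            linarith [Nat.cast_nonneg (α := ℝ) k]
        _ = 2 ^ α * ((k : ℝ) + 1) ^ α := Real.mul_rpow (by norm_num) (by positivity)
        _ ≤ 2 * ((k : ℝ) + 1) ^ α := by
            gcongr
            simpa using Real.rpow_le_rpow_of_exponent_le (one_le_two (α := ℝ)) hα1.le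
    have hBk := hB k
    rw [Real.rpow_add_one (by positivity)] at hBk
    calc (((k + 1 : ℕ) : ℝ) + 1) ^ α * (W * ‖A * w ^ (k + 1)‖)
        ≤ 2 * ((k : ℝ) + 1) ^ α * (W * (‖w ^ (k + 1) * A + (k + 1) * w ^ k * B‖ +
            ((k : ℝ) + 1) * ‖B * w ^ k‖)) := by gcongr
      _ = 2 * (((k : ℝ) + 1) ^ α * (W * ‖w ^ (k + 1) * A + (k + 1) * w ^ k * B‖) +
            ((k : ℝ) + 1) ^ α * ((k : ℝ) + 1) * (W * ‖B * w ^ k‖)) := by ring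
      _ ≤ 34 * C := by linarith [hF k]

/-- Testing a bounded operator on the monomials bounds the combination of the two coefficient
functions. -/
lemma weight_mul_monomial_test_le {α β : ℝ} (hα0 : 0 < α) (hα1 : α < 1) {u φ : ℂ → ℂ}
    (hφd : DifferentiableOn ℂ φ unitDisk) (hφm : Set.MapsTo φ unitDisk unitDisk)
    (hu : MemZygmund β u) {C : ℝ} (hC0 : 0 ≤ C)
    (hmem : ∀ f, MemBloch α f → MemZygmund β (wcomp u φ f))
    (hC : ∀ f, MemBloch α f → zygNorm β (wcomp u φ f) ≤ C * blochNorm α f)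
    (n : ℕ) {z : ℂ} (hz : z ∈ unitDisk) :
    ((n : ℝ) + 1) ^ α * ((1 - ‖z‖ ^ 2) ^ β *
      ‖(2 * deriv u z * deriv φ z + u z * deriv (deriv φ) z) * φ z ^ n
        + u z * deriv φ z ^ 2 * (n * φ z ^ (n - 1))‖) ≤
      2 * C + wnorm β (deriv (deriv u)) := by
  obtain ⟨hb, hbn⟩ := memBloch_pow hα0 hα1 n
  set f : ℂ → ℂ := fun z => z ^ (n + 1) with hf
  have hf' : deriv f = fun z => ((n : ℂ) + 1) * z ^ n := by
    ext z; simp [hf]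
  have hf'' : deriv (deriv f) = fun z => ((n : ℂ) + 1) * (n * z ^ (n - 1)) := by
    rw [hf']; ext z; simp
  have hle : (1 - ‖z‖ ^ 2) ^ β * ‖deriv (deriv (wcomp u φ f)) z‖ ≤
      C * (2 * ((n : ℝ) + 1) ^ (1 - α)) := by
    refine (le_wnorm (hmem f hb).2 hz).trans (le_trans ?_ ((hC f hb).trans (by gcongr)))
    simp only [zygNorm]
    linarith [norm_nonneg (wcomp u φ f 0), norm_nonneg (deriv (wcomp u φ f) 0)]
  have hid := deriv_deriv_wcomp hu.1 hφd hφm hb.1 hz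
  rw [hf'', hf'] at hid
  have hU := le_wnorm hu.2 hz
  have hw := mem_unitDisk.1 (hφm hz)
  have hW := weight_nonneg hz β
  set W := (1 - ‖z‖ ^ 2) ^ β
  set U := wnorm β (deriv (deriv u))
  set G := (2 * deriv u z * deriv φ z + u z * deriv (deriv φ) z) * φ z ^ n
        + u z * deriv φ z ^ 2 * (n * φ z ^ (n - 1)) with hG
  have hn : ‖(n : ℂ) + 1‖ = (n : ℝ) + 1 := by
    exact_mod_cast Complex.norm_natCast (n + 1)
  have hpos : (0 : ℝ) < (n : ℝ) + 1 := by positivity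
  have e : ((n : ℂ) + 1) * G =
      deriv (deriv (wcomp u φ f)) z - deriv (deriv u) z * φ z ^ (n + 1) := by
    rw [hid, hG]; simp only [hf]; ring
  have e1 : ((n : ℝ) + 1) * ‖G‖ ≤
      ‖deriv (deriv (wcomp u φ f)) z‖ + ‖deriv (deriv u) z‖ := by
    rw [← hn, ← norm_mul, e]
    refine (norm_sub_le _ _).trans ?_
    gcongr
    rw [norm_mul, norm_pow]
    exact mul_le_of_le_one_right (norm_nonneg _) (pow_le_one₀ (norm_nonneg _) hw.le)
  have e2 : ((n : ℝ) + 1) ^ (1 - α) * ((n : ℝ) + 1) ^ α = (n : ℝ) + 1 := by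
    rw [← Real.rpow_add hpos]; simp
  have e3 : 1 ≤ ((n : ℝ) + 1) ^ (1 - α) :=
    Real.one_le_rpow (by linarith [Nat.cast_nonneg (α := ℝ) n]) (by linarith)
  have hU0 : 0 ≤ U := wnorm_nonneg _ _
  have hp : 0 < ((n : ℝ) + 1) ^ (1 - α) := by positivity
  refine le_of_mul_le_mul_left ?_ hp
  calc ((n : ℝ) + 1) ^ (1 - α) * (((n : ℝ) + 1) ^ α * (W * ‖G‖))
      = W * (((n : ℝ) + 1) * ‖G‖) := by rw [← mul_assoc, e2]; ring
    _ ≤ W * (‖deriv (deriv (wcomp u φ f)) z‖ + ‖deriv (deriv u) z‖) := by gcongr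
    _ ≤ C * (2 * ((n : ℝ) + 1) ^ (1 - α)) + U := by rw [mul_add]; gcongr
    _ ≤ ((n : ℝ) + 1) ^ (1 - α) * (2 * C + U) := by nlinarith

/-- **Theorem 3.1** (sequential form). For `0 < α < 1`, `uC_φ : B^α → Z_β` is bounded iff
`u ∈ Z_β`, `sup_n (n+1)^α ‖(2u'φ'+uφ'')φ^n‖_ν_β < ∞` and
`sup_n (n+1)^(α+1) ‖u(φ')²φ^n‖_ν_β < ∞`. -/
theorem weighted_comp_bounded_Bloch_to_Zygmund_iff_of_lt_one
    (α β : ℝ) (hα0 : 0 < α) (hα1 : α < 1) (hβ : 0 < β)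
    (u φ : ℂ → ℂ) (hu : DifferentiableOn ℂ u unitDisk)
    (hφd : DifferentiableOn ℂ φ unitDisk) (hφm : Set.MapsTo φ unitDisk unitDisk) :
    BoundedBlochToZygmund α β u φ ↔
      MemZygmund β u ∧
      (∃ C : ℝ, ∀ n : ℕ, ∀ z ∈ unitDisk,
        ((n : ℝ) + 1) ^ α *
          ((1 - ‖z‖ ^ 2) ^ β *
            ‖(2 * deriv u z * deriv φ z + u z * deriv (deriv φ) z) * φ z ^ n‖) ≤ C) ∧
      (∃ C : ℝ, ∀ n : ℕ, ∀ z ∈ unitDisk,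
        ((n : ℝ) + 1) ^ (α + 1) *
          ((1 - ‖z‖ ^ 2) ^ β * ‖u z * deriv φ z ^ 2 * φ z ^ n‖) ≤ C) := by
  constructor
  · rintro ⟨hmem, C, hC0, hC⟩
    have huz : MemZygmund β u := by
      have h := hmem _ (memBloch_one α)
      have e : wcomp u φ (fun _ => 1) = u := by ext z; simp [wcomp]
      rwa [e] at h
    set C' := 2 * C + wnorm β (deriv (deriv u))
    have htest := fun (n : ℕ) {z : ℂ} (hz : z ∈ unitDisk) =>
      weight_mul_monomial_test_le hα0 hα1 hφd hφm huz hC0.le hmem hC n hz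
    have hbd := fun (n : ℕ) (z : ℂ) (hz : z ∈ unitDisk) =>
      coefficient_bounds (α := α) (C := C') hα0 hα1 (weight_nonneg hz β)
        (A := 2 * deriv u z * deriv φ z + u z * deriv (deriv φ) z)
        (B := u z * deriv φ z ^ 2) (mem_unitDisk.1 (hφm hz)).le
        (by simpa using htest 0 hz)
        (fun k => by
          refine le_trans ?_ (htest (k + 1) hz)
          have hW := weight_nonneg hz β
          gcongr ?_ * (_ * ?_)
          · exact Real.rpow_le_rpow (by positivity) (by push_cast; linarith) hα0.le
          · apply le_of_eq
            congr 1
            push_cast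
            ring) n
    exact ⟨huz, ⟨34 * C', fun n z hz => (hbd n z hz).1⟩, ⟨16 * C', fun n z hz => (hbd n z hz).2⟩⟩
  · rintro ⟨huz, ⟨C₁, h₁⟩, ⟨C₂, h₂⟩⟩
    exact boundedBlochToZygmund_of_sequences hα0 hα1 hφd hφm huz h₁ h₂

end
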